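/- Let φ be a smooth solution of the sine-Gordon equation on ℝ² and let U : ℝ²×(0,∞) → M₂(ℂ) be smooth and satisfy the Lax system in (x,y) for each λ > 0, with U(0,0,λ) = I and U(x,y,λ) ∈ SU(2). Define ψ(x,y,λ) := λ·(∂_λU(x,y,λ))·U(x,y,λ)⁻¹. Then for all (x,y) ∈ ℝ² and λ > 0: ⟨∂ₓψ, ∂ₓψ⟩ = λ², ⟨∂_yψ, ∂_yψ⟩ = λ⁻², and ⟨∂ₓψ, ∂_yψ⟩ = cos(φ(x,y)); i.e., the first fundamental form of the Sym immersion ψ(·,·,λ) is λ²dx² + 2cos φ dx dy + λ⁻²dy², so for λ = 1 it is the Tchebychev form dx² + 2cos φ dx dy + dy², and in particular ∂ₓψ and ∂_yψ never vanish. -/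

import Mathlib

open Matrix Complex

attribute [local instance] Matrix.normedAddCommGroup Matrix.normedSpace

noncomputable section

/-- The Pauli matrix σ₃. -/
def sigma3 : Matrix (Fin 2) (Fin 2) ℂ := !![1, 0; 0, -1]

/-- The matrix `A_φ(x,y,λ) = (i/2)·[[∂ₓφ, −λ], [−λ, −∂ₓφ]]` of the Lax system. -/
def Aphi (φ : ℝ → ℝ → ℝ) (lam : ℂ) (x y : ℝ) : Matrix (Fin 2) (Fin 2) ℂ :=
  (Complex.I / 2) •
    !![((deriv (fun x' => φ x' y) x : ℝ) : ℂ), -lam;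
       -lam, -((deriv (fun x' => φ x' y) x : ℝ) : ℂ)]

/-- The matrix `B_φ(x,y,λ) = (i/2)·λ⁻¹·[[0, e^{−iφ}], [e^{iφ}, 0]]` of the Lax system. -/
def Bphi (φ : ℝ → ℝ → ℝ) (lam : ℂ) (x y : ℝ) : Matrix (Fin 2) (Fin 2) ℂ :=
  (Complex.I / 2) • lam⁻¹ •
    !![0, Complex.exp (-Complex.I * ((φ x y : ℝ) : ℂ));
       Complex.exp (Complex.I * ((φ x y : ℝ) : ℂ)), 0]

/-- Membership in SU(2): unitary with determinant one. -/
def IsSU2 (g : Matrix (Fin 2) (Fin 2) ℂ) : Prop := g * gᴴ = 1 ∧ g.det = 1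

/-- The bilinear pairing `⟨X,Y⟩ = −2·tr(X·Y)` on 2×2 complex matrices. -/
def pairing (X Y : Matrix (Fin 2) (Fin 2) ℂ) : ℂ := -2 * (X * Y).trace

/-- The Sym formula: `ψ(x,y,λ) = λ·(∂_λU)·U⁻¹`. -/
def symMap (U : ℝ → ℝ → ℝ → Matrix (Fin 2) (Fin 2) ℂ) (x y lam : ℝ) :
    Matrix (Fin 2) (Fin 2) ℂ :=
  (lam : ℂ) • (deriv (fun l : ℝ => U x y l) lam * (U x y lam)⁻¹)

/-- The extended frame hypotheses: `U` is smooth on `ℝ² × (0,∞)`, solves the Lax system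
of `φ` for each `λ > 0`, satisfies `U(0,0,λ) = I`, and takes values in SU(2). -/
def IsExtendedFrame (φ : ℝ → ℝ → ℝ) (U : ℝ → ℝ → ℝ → Matrix (Fin 2) (Fin 2) ℂ) : Prop :=
  ContDiffOn ℝ (⊤ : ℕ∞) (fun p : ℝ × ℝ × ℝ => U p.1 p.2.1 p.2.2)
    (Set.univ ×ˢ Set.univ ×ˢ Set.Ioi 0) ∧
  (∀ lam : ℝ, 0 < lam → ∀ x y : ℝ,
    HasDerivAt (fun x' => U x' y lam) (U x y lam * Aphi φ (lam : ℂ) x y) x ∧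
    HasDerivAt (fun y' => U x y' lam) (U x y lam * Bphi φ (lam : ℂ) x y) y) ∧
  (∀ lam : ℝ, 0 < lam → U 0 0 lam = 1) ∧
  (∀ x y lam : ℝ, 0 < lam → IsSU2 (U x y lam))

/-- Symmetry of mixed partial derivatives of a twice continuously differentiable function of two
real variables, where the first partial derivative along a line is given explicitly by `G`. -/
lemma hasDerivAt_deriv_of_contDiffAt {E : Type*} [NormedAddCommGroup E] [NormedSpace ℝ E]
    {F : ℝ → ℝ → E} {G : ℝ → E} {G' : E} {t l : ℝ}
    (hF : ContDiffAt ℝ 2 (fun p : ℝ × ℝ => F p.1 p.2) (t, l))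
    (hG : ∀ᶠ k in nhds l, HasDerivAt (fun s => F s k) (G k) t) (hG' : HasDerivAt G G' l) :
    HasDerivAt (fun s => deriv (F s) l) G' t := by
  set f : ℝ × ℝ → E := fun p => F p.1 p.2
  have hdiff : ∀ᶠ p in nhds (t, l), DifferentiableAt ℝ f p :=
    (hF.eventually (by simp)).mono fun p hp => hp.differentiableAt (by simp)
  have hline₁ (k : ℝ) : HasDerivAt (fun s : ℝ => (s, k)) ((1, 0) : ℝ × ℝ) t :=
    (hasDerivAt_id t).prodMk (hasDerivAt_const t k)
  have hline₂ (s : ℝ) : HasDerivAt (fun k : ℝ => (s, k)) ((0, 1) : ℝ × ℝ) l :=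
    (hasDerivAt_const l s).prodMk (hasDerivAt_id l)
  have hfd : HasFDerivAt (fderiv ℝ f) (fderiv ℝ (fderiv ℝ f) (t, l)) (t, l) :=
    ((hF.fderiv_right (m := 1) (by norm_num)).differentiableAt (by simp)).hasFDerivAt
  have hsymm : IsSymmSndFDerivAt ℝ f (t, l) := hF.isSymmSndFDerivAt (by simp)
  have hmixed : G' = fderiv ℝ (fderiv ℝ f) (t, l) (0, 1) (1, 0) := by
    refine hG'.unique ?_
    have h : HasDerivAt (fun k => fderiv ℝ f (t, k) (1, 0))
        (fderiv ℝ (fderiv ℝ f) (t, l) (0, 1) (1, 0)) l :=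
      (ContinuousLinearMap.apply ℝ E ((1, 0) : ℝ × ℝ)).hasFDerivAt.comp_hasDerivAt l
        (hfd.comp_hasDerivAt l (hline₂ t))
    refine h.congr_of_eventuallyEq ?_
    filter_upwards [hG, (hline₂ t).continuousAt.eventually hdiff] with k hk hd
    have hcomp : HasDerivAt (fun s => F s k) (fderiv ℝ f (t, k) (1, 0)) t :=
      HasFDerivAt.comp_hasDerivAt (l := f) t hd.hasFDerivAt (hline₁ k)
    exact hk.unique hcomp
  rw [hmixed, hsymm]
  have h : HasDerivAt (fun s => fderiv ℝ f (s, l) (0, 1))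
      (fderiv ℝ (fderiv ℝ f) (t, l) (1, 0) (0, 1)) t :=
    (ContinuousLinearMap.apply ℝ E ((0, 1) : ℝ × ℝ)).hasFDerivAt.comp_hasDerivAt t
      (hfd.comp_hasDerivAt t (hline₁ l))
  refine h.congr_of_eventuallyEq ?_
  filter_upwards [(hline₁ l).continuousAt.eventually hdiff] with s hd
  have hcomp : HasDerivAt (F s) (fderiv ℝ f (s, l) (0, 1)) l :=
    hd.hasFDerivAt.comp_hasDerivAt l (hline₂ s)
  exact hcomp.deriv

lemma hasDerivAt_matrix_iff {m n : Type*} [Fintype m] [Fintype n] {F : ℝ → Matrix m n ℂ}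
    {F' : Matrix m n ℂ} {t : ℝ} :
    HasDerivAt F F' t ↔ ∀ i j, HasDerivAt (fun s => F s i j) (F' i j) t :=
  hasDerivAt_pi.trans (forall_congr' fun _ => hasDerivAt_pi)

lemma HasDerivAt.matrix_mul {l m n : Type*} [Fintype l] [Fintype m] [Fintype n]
    {F : ℝ → Matrix l m ℂ} {G : ℝ → Matrix m n ℂ}
    {F' : Matrix l m ℂ} {G' : Matrix m n ℂ} {t : ℝ}
    (hF : HasDerivAt F F' t) (hG : HasDerivAt G G' t) :
    HasDerivAt (fun s => F s * G s) (F' * G t + F t * G') t := by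
  rw [hasDerivAt_matrix_iff] at *
  intro i j
  simp only [Matrix.mul_apply, Matrix.add_apply, ← Finset.sum_add_distrib]
  exact HasDerivAt.fun_sum fun k _ => (hF i k).mul (hG k j)

/-- A curve in `SL(2, ℂ)` with logarithmic derivative `A`: the derivative of its inverse. -/
lemma hasDerivAt_inv_of_det_eq_one {F : ℝ → Matrix (Fin 2) (Fin 2) ℂ}
    {A : Matrix (Fin 2) (Fin 2) ℂ} {t : ℝ} (hdet : ∀ s, (F s).det = 1) (hA : A.trace = 0)
    (hF : HasDerivAt F (F t * A) t) :
    HasDerivAt (fun s => (F s)⁻¹) (-(A * (F t)⁻¹)) t := by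
  have hinv (s : ℝ) : (F s)⁻¹ = !![F s 1 1, -F s 0 1; -F s 1 0, F s 0 0] := by
    rw [Matrix.inv_def, hdet, Ring.inverse_one, one_smul, Matrix.adjugate_fin_two]
  have hA' : A 1 1 = -A 0 0 := by
    rw [Matrix.trace_fin_two] at hA
    linear_combination hA
  have hadj : -(A * (F t)⁻¹) =
      !![(F t * A) 1 1, -(F t * A) 0 1; -(F t * A) 1 0, (F t * A) 0 0] := by
    rw [hinv]
    ext i j
    fin_cases i <;> fin_cases j <;>
      simp [Matrix.mul_apply, Fin.sum_univ_two, hA'] <;> ring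
  rw [hadj]
  simp only [hinv]
  rw [hasDerivAt_matrix_iff] at *
  intro i j
  fin_cases i <;> fin_cases j
  · exact hF 1 1
  · exact (hF 0 1).neg
  · exact (hF 1 0).neg
  · exact hF 0 0

/-- If `F` has logarithmic derivative `A` in the first variable, then the Sym expression
`l • (∂_l F) F⁻¹` has derivative `l • F (∂_l A) F⁻¹` in the first variable. -/
lemma hasDerivAt_sym {F : ℝ → ℝ → Matrix (Fin 2) (Fin 2) ℂ}
    {A : ℝ → Matrix (Fin 2) (Fin 2) ℂ} {A' : Matrix (Fin 2) (Fin 2) ℂ} {t l : ℝ}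
    (hF : ContDiffAt ℝ 2 (fun p : ℝ × ℝ => F p.1 p.2) (t, l))
    (hdet : ∀ s, (F s l).det = 1) (hA : (A l).trace = 0)
    (hFA : ∀ᶠ k in nhds l, HasDerivAt (fun s => F s k) (F t k * A k) t)
    (hA' : HasDerivAt A A' l) :
    HasDerivAt (fun s => (l : ℂ) • (deriv (F s) l * (F s l)⁻¹))
      ((l : ℂ) • (F t l * A' * (F t l)⁻¹)) t := by
  have hFl : HasDerivAt (F t) (deriv (F t) l) l := by
    have h : DifferentiableAt ℝ (fun p : ℝ × ℝ => F p.1 p.2) (t, l) :=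
      hF.differentiableAt (by simp)
    exact (h.comp l (by fun_prop : DifferentiableAt ℝ (fun k : ℝ => (t, k)) l)).hasDerivAt
  have hmixed := hasDerivAt_deriv_of_contDiffAt hF hFA (hFl.matrix_mul hA')
  have hinv := hasDerivAt_inv_of_det_eq_one hdet hA hFA.self_of_nhds
  have hcancel : F t l * A' * (F t l)⁻¹ = (deriv (F t) l * A l + F t l * A') * (F t l)⁻¹
      + deriv (F t) l * -(A l * (F t l)⁻¹) := by
    rw [Matrix.add_mul, Matrix.mul_neg, Matrix.mul_assoc (deriv (F t) l)]
    abel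
  rw [hcancel]
  exact (hmixed.matrix_mul hinv).const_smul (l : ℂ)

lemma pairing_smul_conj {P : Matrix (Fin 2) (Fin 2) ℂ} (hP : P.det = 1) (c : ℂ)
    (X Y : Matrix (Fin 2) (Fin 2) ℂ) :
    pairing (c • (P * X * P⁻¹)) (c • (P * Y * P⁻¹)) = c ^ 2 * pairing X Y := by
  have hunit : IsUnit P.det := by simp [hP]
  have h : P * X * P⁻¹ * (P * Y * P⁻¹) = P * (X * Y) * P⁻¹ := by
    simp only [Matrix.mul_assoc, Matrix.nonsing_inv_mul_cancel_left _ _ hunit]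
  rw [pairing, pairing, Matrix.smul_mul, Matrix.mul_smul, h, Matrix.trace_smul,
    Matrix.trace_smul, Matrix.trace_mul_comm, Matrix.nonsing_inv_mul_cancel_left _ _ hunit]
  simp only [smul_eq_mul]
  ring

lemma hasDerivAt_Aphi (φ : ℝ → ℝ → ℝ) (x y l : ℝ) :
    HasDerivAt (fun k : ℝ => Aphi φ (k : ℂ) x y) ((Complex.I / 2) • !![0, -1; -1, 0]) l := by
  have hid : HasDerivAt (fun k : ℝ => (k : ℂ)) 1 l := Complex.ofRealCLM.hasDerivAt
  refine HasDerivAt.const_smul (Complex.I / 2) (hasDerivAt_matrix_iff.2 fun i j => ?_)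
  fin_cases i <;> fin_cases j
  · exact hasDerivAt_const _ _
  · exact hid.neg
  · exact hid.neg
  · exact hasDerivAt_const _ _

lemma hasDerivAt_Bphi (φ : ℝ → ℝ → ℝ) (x y : ℝ) {l : ℝ} (hl : l ≠ 0) :
    HasDerivAt (fun k : ℝ => Bphi φ (k : ℂ) x y)
      ((Complex.I / 2) • (-((l : ℂ) ^ 2)⁻¹) •
        !![0, Complex.exp (-Complex.I * ((φ x y : ℝ) : ℂ));
           Complex.exp (Complex.I * ((φ x y : ℝ) : ℂ)), 0]) l := by
  have hinv : HasDerivAt (fun k : ℝ => (k : ℂ)⁻¹) (-((l : ℂ) ^ 2)⁻¹) l :=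
    (hasDerivAt_inv (Complex.ofReal_ne_zero.2 hl)).comp_ofReal
  exact (hinv.smul_const _).const_smul (Complex.I / 2)

/-- First fundamental form of the Sym immersion: for the associated family `ψ(·,·,λ)` one has
`⟨ψₓ,ψₓ⟩ = λ²`, `⟨ψ_y,ψ_y⟩ = λ⁻²` and `⟨ψₓ,ψ_y⟩ = cos φ`, i.e. the first fundamental form is
`λ²dx² + 2cos φ dxdy + λ⁻²dy²` (for `λ = 1` the Tchebychev form `dx² + 2cos φ dxdy + dy²`);
in particular `ψₓ` and `ψ_y` never vanish. -/
theorem sym_first_fundamental_form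
    (φ : ℝ → ℝ → ℝ) (hφ : ContDiff ℝ (⊤ : ℕ∞) (fun p : ℝ × ℝ => φ p.1 p.2))
    (hsg : ∀ x y : ℝ, deriv (fun x' => deriv (fun y' => φ x' y') y) x = Real.sin (φ x y))
    (U : ℝ → ℝ → ℝ → Matrix (Fin 2) (Fin 2) ℂ)
    (hU : IsExtendedFrame φ U) :
    ∀ x y lam : ℝ, 0 < lam →
      pairing (deriv (fun x' => symMap U x' y lam) x) (deriv (fun x' => symMap U x' y lam) x)
          = (lam : ℂ) ^ 2 ∧
      pairing (deriv (fun y' => symMap U x y' lam) y) (deriv (fun y' => symMap U x y' lam) y)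
          = ((lam : ℂ) ^ 2)⁻¹ ∧
      pairing (deriv (fun x' => symMap U x' y lam) x) (deriv (fun y' => symMap U x y' lam) y)
          = ((Real.cos (φ x y) : ℝ) : ℂ) ∧
      deriv (fun x' => symMap U x' y lam) x ≠ 0 ∧
      deriv (fun y' => symMap U x y' lam) y ≠ 0 := by
  intro x y lam hlam
  obtain ⟨hsmooth, hlax, -, hSU⟩ := hU
  have hcontDiff : ContDiffAt ℝ 2 (fun p : ℝ × ℝ × ℝ => U p.1 p.2.1 p.2.2) (x, y, lam) :=
    (hsmooth.contDiffAt ((isOpen_univ.prod (isOpen_univ.prod isOpen_Ioi)).mem_nhds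
      (by simpa using hlam))).of_le (by norm_cast)
  have hpos : ∀ᶠ k in nhds lam, 0 < k := lt_mem_nhds hlam
  have hx := hasDerivAt_sym (F := fun s k => U s y k)
    (hcontDiff.comp (x, lam) (f := fun p : ℝ × ℝ => (p.1, y, p.2)) (by fun_prop))
    (fun s => (hSU s y lam hlam).2) (by simp [Aphi, Matrix.trace_fin_two])
    (hpos.mono fun k hk => (hlax k hk x y).1) (hasDerivAt_Aphi φ x y lam)
  have hy := hasDerivAt_sym (F := fun s k => U x s k)
    (hcontDiff.comp (y, lam) (f := fun p : ℝ × ℝ => (x, p.1, p.2)) (by fun_prop))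
    (fun s => (hSU x s lam hlam).2) (by simp [Bphi, Matrix.trace_fin_two])
    (hpos.mono fun k hk => (hlax k hk x y).2) (hasDerivAt_Bphi φ x y hlam.ne')
  have hψx : deriv (fun x' => symMap U x' y lam) x = _ := hx.deriv
  have hψy : deriv (fun y' => symMap U x y' lam) y = _ := hy.deriv
  have hlamC : (lam : ℂ) ≠ 0 := Complex.ofReal_ne_zero.2 hlam.ne'
  have hexp : Complex.exp (-Complex.I * φ x y) * Complex.exp (Complex.I * φ x y) = 1 := by
    rw [← Complex.exp_add]
    simp
  have hcos : Complex.exp (-Complex.I * φ x y) + Complex.exp (Complex.I * φ x y)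
      = 2 * ((Real.cos (φ x y) : ℝ) : ℂ) := by
    rw [Complex.ofReal_cos, Complex.two_cos, add_comm, mul_comm Complex.I, neg_mul, neg_mul,
      mul_comm Complex.I]
  generalize Complex.exp (-Complex.I * φ x y) = p at hψy hexp hcos
  generalize Complex.exp (Complex.I * φ x y) = q at hψy hexp hcos
  have hdet := (hSU x y lam hlam).2
  have hxx : pairing (deriv (fun x' => symMap U x' y lam) x)
      (deriv (fun x' => symMap U x' y lam) x) = (lam : ℂ) ^ 2 := by
    rw [hψx, pairing_smul_conj hdet]
    simp [pairing, Matrix.trace_fin_two]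
    linear_combination (-(lam : ℂ) ^ 2) * Complex.I_sq
  have hyy : pairing (deriv (fun y' => symMap U x y' lam) y)
      (deriv (fun y' => symMap U x y' lam) y) = ((lam : ℂ) ^ 2)⁻¹ := by
    rw [hψy, pairing_smul_conj hdet]
    simp only [pairing, Matrix.trace_fin_two, Matrix.mul_apply, Fin.sum_univ_two,
      Matrix.smul_apply, smul_eq_mul, Matrix.of_apply, Matrix.cons_val', Matrix.cons_val_zero,
      Matrix.cons_val_one, Matrix.cons_val_fin_one]
    field_simp
    linear_combination (-2 * Complex.I ^ 2) * hexp - 2 * Complex.I_sq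
  have hxy : pairing (deriv (fun x' => symMap U x' y lam) x)
      (deriv (fun y' => symMap U x y' lam) y) = ((Real.cos (φ x y) : ℝ) : ℂ) := by
    rw [hψx, hψy, pairing_smul_conj hdet]
    simp only [pairing, Matrix.trace_fin_two, Matrix.mul_apply, Fin.sum_univ_two,
      Matrix.smul_apply, smul_eq_mul, Matrix.of_apply, Matrix.cons_val', Matrix.cons_val_zero,
      Matrix.cons_val_one, Matrix.cons_val_fin_one]
    field_simp
    linear_combination (-Complex.I ^ 2) * hcos - 2 * ((Real.cos (φ x y) : ℝ) : ℂ) * Complex.I_sq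
  refine ⟨hxx, hyy, hxy, fun h => ?_, fun h => ?_⟩
  · rw [h] at hxx
    exact pow_ne_zero 2 hlamC (by simpa [pairing] using hxx.symm)
  · rw [h] at hyy
    exact inv_ne_zero (pow_ne_zero 2 hlamC) (by simpa [pairing] using hyy.symm)

end
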